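/- In a structured semigroup (S, N, Z), let A ⊆ S be an atlas and a, b ∈ A^<. Then the following are equivalent: (i) a ~_A b; (ii) (^ZA)a(A^Z) ∩ (^ZA)b(A^Z) ≠ ∅, where (^ZA)a(A^Z) = {yaz : y ∈ ^ZA, z ∈ A^Z}; (iii) there exists s ∈ A^* with sa = sb ∈ A^Z and as = bs ∈ ^ZA. -/

import Mathlib

open Pointwise

variable {S : Type*}

/-- `a <_s b`: the domination relation via `s`. -/
def domBy [Semigroup S] (N Z : Set S) (a s b : S) : Prop :=
  a * s * b = a ∧ b * s * a = a ∧ a * s ∈ N ∧ s * a ∈ N ∧ b * s ∈ Z ∧ s * b ∈ Z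

/-- `a < b`: domination. -/
def domRel [Semigroup S] (N Z : Set S) (a b : S) : Prop := ∃ s, domBy N Z a s b

/-- The up-closure `A^<`. -/
def upClo [Semigroup S] (N Z : Set S) (A : Set S) : Set S :=
  {b | ∃ a ∈ A, domRel N Z a b}

/-- The dual `A^*`. -/
def dualSet [Semigroup S] (N Z : Set S) (A : Set S) : Set S :=
  {s | ∃ a ∈ A, ∃ b, domBy N Z a s b}

/-- Structured semigroup data on `(S, N, Z)`. -/
structure Structured [Semigroup S] (N Z : Set S) : Prop where
  nMul : ∀ m ∈ N, ∀ n ∈ N, m * n ∈ N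
  zMul : ∀ y ∈ Z, ∀ z ∈ Z, y * z ∈ Z
  zSubN : Z ⊆ N
  zComm : ∀ z ∈ Z, ∀ n ∈ N, z * n = n * z
  binormal : ∀ a b : S, a * b ∈ Z → b * a ∈ Z → ∀ z ∈ Z, a * z * b ∈ Z ∧ b * z * a ∈ Z
  trinormal : ∀ a b : S, ∀ n ∈ N, a * b * n = n → n * a * b = n →
    a * b ∈ Z → b * a ∈ Z → b * n * a ∈ N

/-- An atlas: `A A^* A ⊆ A ⊆ A^<`. -/
def IsAtlas [Semigroup S] (N Z : Set S) (A : Set S) : Prop :=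
  A * dualSet N Z A * A ⊆ A ∧ A ⊆ upClo N Z A

/-- A coset: `A A^* A ⊆ A = A^<`. -/
def IsCoset [Semigroup S] (N Z : Set S) (A : Set S) : Prop :=
  A * dualSet N Z A * A ⊆ A ∧ upClo N Z A = A

/-- Source `s(A) = (A^* A)^<`. -/
def srcSet [Semigroup S] (N Z : Set S) (A : Set S) : Set S :=
  upClo N Z (dualSet N Z A * A)

/-- Range `r(A) = (A A^*)^<`. -/
def rngSet [Semigroup S] (N Z : Set S) (A : Set S) : Set S :=
  upClo N Z (A * dualSet N Z A)

/-- `A|b`: `b` acts on `A` from the right. -/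
def actsR [Semigroup S] (Z : Set S) (A : Set S) (b : S) : Prop :=
  ∃ b', b * b' ∈ Z ∧ b' * b ∈ Z ∧ ∃ a ∈ A, a * b * b' = a

/-- `b|A`: `b` acts on `A` from the left. -/
def actsL [Semigroup S] (Z : Set S) (b : S) (A : Set S) : Prop :=
  ∃ b', b * b' ∈ Z ∧ b' * b ∈ Z ∧ ∃ a ∈ A, b' * b * a = a

/-- `A^Z = {z ∈ Z : az = a for some a ∈ A}`. -/
def AZset [Semigroup S] (Z : Set S) (A : Set S) : Set S :=
  {z ∈ Z | ∃ a ∈ A, a * z = a}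

/-- `^Z A = {z ∈ Z : za = a for some a ∈ A}`. -/
def ZAset [Semigroup S] (Z : Set S) (A : Set S) : Set S :=
  {z ∈ Z | ∃ a ∈ A, z * a = a}

/-- The equivalence relation `a ~_A b`. -/
def eqvA [Semigroup S] (N Z : Set S) (A : Set S) (a b : S) : Prop :=
  ∃ s ∈ dualSet N Z A, ∃ t ∈ dualSet N Z A, s * a * t = s * b * t

/-- `Y` is symmetric: `ab ∈ Y → baba ∈ Y`. -/
def IsSymmetric [Semigroup S] (Y : Set S) : Prop :=
  ∀ a b : S, a * b ∈ Y → b * a * b * a ∈ Y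

/-- `D` is diagonal: `ad, d, db ∈ D → adb ∈ D`. -/
def IsDiagonal [Semigroup S] (D : Set S) : Prop :=
  ∀ a d b : S, a * d ∈ D → d ∈ D → d * b ∈ D → a * d * b ∈ D

section Auxiliary

variable [Semigroup S] {N Z A : Set S}

/-- Domination is multiplicative. -/
theorem domBy.mul (h : Structured N Z) {a s b c t d : S}
    (hab : domBy N Z a s b) (hcd : domBy N Z c t d) :
    domBy N Z (a * c) (t * s) (b * d) := by
  obtain ⟨h1, h2, h3, h4, h5, h6⟩ := hab
  obtain ⟨k1, k2, k3, k4, k5, k6⟩ := hcd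
  have e1 := h.zComm _ h6 _ k3
  have e2 := h.zComm _ k5 _ h4
  have hn := h.nMul _ h4 _ k3
  have n1 : s * b * (s * a * (c * t)) = s * a * (c * t) := by
    rw [show s * b * (s * a * (c * t)) = s * (b * s * a) * (c * t) by simp only [mul_assoc], h2]
  have n2 : s * a * (c * t) * s * b = s * a * (c * t) := by
    rw [mul_assoc _ s b, mul_assoc _ (c * t), ← e1,
      show s * a * (s * b * (c * t)) = s * (a * s * b) * (c * t) by simp only [mul_assoc], h1]
  have n3 : d * t * (s * a * (c * t)) = s * a * (c * t) := by
    rw [← mul_assoc (d * t), e2,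
      show s * a * (d * t) * (c * t) = s * a * (d * t * c * t) by simp only [mul_assoc], k2]
  have n4 : s * a * (c * t) * d * t = s * a * (c * t) := by
    rw [show s * a * (c * t) * d * t = s * a * (c * t * d * t) by simp only [mul_assoc], k1]
  have m1 := h.trinormal s b _ hn n1 n2 h6 h5
  have m2 := h.trinormal d t _ hn n3 n4 k5 k6
  have b1 := (h.binormal b s h5 h6 _ k5).1
  have b2 := (h.binormal t d k6 k5 _ h6).1
  refine ⟨?_, ?_, ?_, ?_, ?_, ?_⟩
  · rw [show a * c * (t * s) * (b * d) = a * (c * t * (s * b)) * d by simp only [mul_assoc], ← e1,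
      show a * (s * b * (c * t)) * d = a * s * b * (c * t * d) by simp only [mul_assoc], h1, k1]
  · rw [show b * d * (t * s) * (a * c) = b * (d * t * (s * a)) * c by simp only [mul_assoc], e2,
      show b * (s * a * (d * t)) * c = b * s * a * (d * t * c) by simp only [mul_assoc], h2, k2]
  · rwa [show b * (s * a * (c * t)) * s = b * s * a * c * (t * s) by simp only [mul_assoc],
      h2] at m1
  · rwa [show t * (s * a * (c * t)) * d = t * s * (a * (c * t * d)) by simp only [mul_assoc],
      k1] at m2
  · rwa [show b * d * (t * s) = b * (d * t) * s by simp only [mul_assoc]]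
  · rwa [show t * s * (b * d) = t * (s * b) * d by simp only [mul_assoc]]

/-- If `a <_s b` then `sas <_b s`. -/
theorem domBy.dual {a s b : S} (hab : domBy N Z a s b) : domBy N Z (s * a * s) b s := by
  obtain ⟨h1, h2, h3, h4, h5, h6⟩ := hab
  refine ⟨?_, ?_, ?_, ?_, h6, h5⟩
  · rw [show s * a * s * b * s = s * (a * s * b) * s by simp only [mul_assoc], h1]
  · rw [show s * b * (s * a * s) = s * (b * s * a) * s by simp only [mul_assoc], h2]
  · rwa [show s * a * s * b = s * (a * s * b) by simp only [mul_assoc], h1]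
  · rwa [show b * (s * a * s) = b * s * a * s by simp only [mul_assoc], h2]

theorem IsAtlas.mul_mem (hA : IsAtlas N Z A) {a s b : S} (ha : a ∈ A)
    (hs : s ∈ dualSet N Z A) (hb : b ∈ A) : a * s * b ∈ A :=
  hA.1 (Set.mul_mem_mul (Set.mul_mem_mul ha hs) hb)

theorem IsAtlas.dual_mul_mem (h : Structured N Z) (hA : IsAtlas N Z A) {s a t : S}
    (hs : s ∈ dualSet N Z A) (ha : a ∈ upClo N Z A) (ht : t ∈ dualSet N Z A) :
    s * a * t ∈ dualSet N Z A := by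
  obtain ⟨a₁, ha₁, b₁, h₁⟩ := hs
  obtain ⟨a₂, ha₂, b₂, h₂⟩ := ht
  obtain ⟨a', ha', u, hu⟩ := ha
  have hu' : u ∈ dualSet N Z A := ⟨a', ha', a, hu⟩
  refine ⟨a₂ * (u * a' * u) * a₁, ?_, b₂ * u * b₁, ?_⟩
  · rw [show a₂ * (u * a' * u) * a₁ = a₂ * u * a' * u * a₁ by simp only [mul_assoc]]
    exact hA.mul_mem (hA.mul_mem ha₂ hu' ha') hu' ha₁
  · rw [mul_assoc s]
    exact (h₂.mul h hu.dual).mul h h₁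

theorem IsAtlas.exists_of_mem_AZset (h : Structured N Z) (hA : IsAtlas N Z A) {z : S}
    (hz : z ∈ AZset Z A) : ∃ c ∈ A, ∃ r ∈ dualSet N Z A,
      c * z = c ∧ r * c ∈ N ∧ r * c * z = r * c ∧ z * (r * c) = r * c := by
  obtain ⟨hz, d, hd, hdz⟩ := hz
  obtain ⟨c, hc, r, hr⟩ := hA.2 hd
  have e := h.zComm _ hz _ hr.2.2.2.1
  have hcz : c * z = c := by
    rw [← hr.1, mul_assoc c r d, mul_assoc c, mul_assoc r, hdz]
  have hrc : r * c * z = r * c := by rw [mul_assoc, hcz]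
  exact ⟨c, hc, r, ⟨c, hc, d, hr⟩, hcz, hr.2.2.2.1, hrc, e.trans hrc⟩

theorem IsAtlas.exists_of_mem_ZAset (h : Structured N Z) (hA : IsAtlas N Z A) {y : S}
    (hy : y ∈ ZAset Z A) : ∃ c ∈ A, ∃ r ∈ dualSet N Z A,
      y * c = c ∧ c * r ∈ N ∧ y * (c * r) = c * r ∧ c * r * y = c * r := by
  obtain ⟨hy, d, hd, hyd⟩ := hy
  obtain ⟨c, hc, r, hr⟩ := hA.2 hd
  have e := h.zComm _ hy _ hr.2.2.1
  have hyc : y * c = c := by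
    rw [← hr.2.1, ← mul_assoc, ← mul_assoc, hyd]
  have hcr : y * (c * r) = c * r := by rw [← mul_assoc, hyc]
  exact ⟨c, hc, r, ⟨c, hc, d, hr⟩, hyc, hr.2.2.1, hcr, e.symm.trans hcr⟩

theorem IsAtlas.AZset_mul_mem (h : Structured N Z) (hA : IsAtlas N Z A) {z w : S}
    (hz : z ∈ AZset Z A) (hw : w ∈ AZset Z A) : z * w ∈ AZset Z A := by
  obtain ⟨c, hc, r, hr, c1, c2, c3, c4⟩ := hA.exists_of_mem_AZset h hz
  obtain ⟨d, hd, q, hq, d1, d2, d3, d4⟩ := hA.exists_of_mem_AZset h hw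
  refine ⟨h.zMul _ hz.1 _ hw.1, c * q * d, hA.mul_mem hc hq hd, ?_⟩
  have e := h.zComm _ hz.1 _ d2
  calc c * q * d * (z * w) = c * (q * d * z) * w := by simp only [mul_assoc]
    _ = c * z * q * (d * w) := by rw [← e]; simp only [mul_assoc]
    _ = c * q * d := by rw [c1, d1]

theorem IsAtlas.ZAset_mul_mem (h : Structured N Z) (hA : IsAtlas N Z A) {y x : S}
    (hy : y ∈ ZAset Z A) (hx : x ∈ ZAset Z A) : y * x ∈ ZAset Z A := by
  obtain ⟨c, hc, r, hr, c1, c2, c3, c4⟩ := hA.exists_of_mem_ZAset h hy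
  obtain ⟨d, hd, q, hq, d1, d2, d3, d4⟩ := hA.exists_of_mem_ZAset h hx
  refine ⟨h.zMul _ hy.1 _ hx.1, c * r * d, hA.mul_mem hc hr hd, ?_⟩
  have e := h.zComm _ hx.1 _ c2
  calc y * x * (c * r * d) = y * (x * (c * r)) * d := by simp only [mul_assoc]
    _ = y * c * r * (x * d) := by rw [e]; simp only [mul_assoc]
    _ = c * r * d := by rw [c1, d1]

/-- Conjugating `^ZA` by an element of the up-closure lands in `A^Z`. -/
theorem IsAtlas.conj_mem_AZset (h : Structured N Z) (hA : IsAtlas N Z A) {a' u a y : S}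
    (ha' : a' ∈ A) (hu : domBy N Z a' u a) (hy : y ∈ ZAset Z A) : u * y * a ∈ AZset Z A := by
  obtain ⟨c, hc, r, hr, c1, c2, c3, c4⟩ := hA.exists_of_mem_ZAset h hy
  obtain ⟨h1, h2, h3, h4, h5, h6⟩ := hu
  refine ⟨(h.binormal u a h6 h5 y hy.1).1, c * r * a', hA.mul_mem hc hr ha', ?_⟩
  have e := h.zComm _ hy.1 _ h3
  calc c * r * a' * (u * y * a) = c * r * (a' * u * y) * a := by simp only [mul_assoc]
    _ = c * r * y * (a' * u * a) := by rw [← e]; simp only [mul_assoc]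
    _ = c * r * a' := by rw [c4, h1]

/-- Conjugating `A^Z` by an element of the up-closure lands in `^ZA`. -/
theorem IsAtlas.conj_mem_ZAset (h : Structured N Z) (hA : IsAtlas N Z A) {a' u a z : S}
    (ha' : a' ∈ A) (hu : domBy N Z a' u a) (hz : z ∈ AZset Z A) : a * z * u ∈ ZAset Z A := by
  obtain ⟨c, hc, r, hr, c1, c2, c3, c4⟩ := hA.exists_of_mem_AZset h hz
  obtain ⟨h1, h2, h3, h4, h5, h6⟩ := hu
  refine ⟨(h.binormal a u h5 h6 z hz.1).1, a' * r * c, hA.mul_mem ha' hr hc, ?_⟩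
  have e := h.zComm _ hz.1 _ h4
  calc a * z * u * (a' * r * c) = a * (z * (u * a')) * r * c := by simp only [mul_assoc]
    _ = a * u * a' * (z * (r * c)) := by rw [e]; simp only [mul_assoc]
    _ = a' * r * c := by rw [c4, h2, mul_assoc]

theorem IsAtlas.exists_dual_absorb_right (h : Structured N Z) (hA : IsAtlas N Z A) {y x : S}
    (hy : y ∈ ZAset Z A) (hx : x ∈ ZAset Z A) :
    ∃ s ∈ dualSet N Z A, s * y = s ∧ s * x = s := by
  obtain ⟨c, hc, r, hr, c1, c2, c3, c4⟩ := hA.exists_of_mem_ZAset h hy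
  obtain ⟨d, hd, q, hq, d1, d2, d3, d4⟩ := hA.exists_of_mem_ZAset h hx
  have e := h.zComm _ hy.1 _ d2
  refine ⟨r * (c * r * d) * q, hA.dual_mul_mem h hr (hA.2 (hA.mul_mem hc hr hd)) hq, ?_, ?_⟩
  · calc r * (c * r * d) * q * y = r * (c * r) * (d * q * y) := by simp only [mul_assoc]
      _ = r * (c * r * y) * (d * q) := by rw [← e]; simp only [mul_assoc]
      _ = r * (c * r * d) * q := by rw [c4]; simp only [mul_assoc]
  · calc r * (c * r * d) * q * x = r * (c * r) * (d * q * x) := by simp only [mul_assoc]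
      _ = r * (c * r * d) * q := by rw [d4]; simp only [mul_assoc]

theorem IsAtlas.exists_dual_absorb_left (h : Structured N Z) (hA : IsAtlas N Z A) {z w : S}
    (hz : z ∈ AZset Z A) (hw : w ∈ AZset Z A) :
    ∃ t ∈ dualSet N Z A, z * t = t ∧ w * t = t := by
  obtain ⟨c, hc, r, hr, c1, c2, c3, c4⟩ := hA.exists_of_mem_AZset h hz
  obtain ⟨d, hd, q, hq, d1, d2, d3, d4⟩ := hA.exists_of_mem_AZset h hw
  have e := h.zComm _ hw.1 _ c2
  refine ⟨r * (c * q * d) * q, hA.dual_mul_mem h hr (hA.2 (hA.mul_mem hc hq hd)) hq, ?_, ?_⟩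
  · calc z * (r * (c * q * d) * q) = z * (r * c) * (q * d * q) := by simp only [mul_assoc]
      _ = r * (c * q * d) * q := by rw [c4]; simp only [mul_assoc]
  · calc w * (r * (c * q * d) * q) = w * (r * c) * (q * d * q) := by simp only [mul_assoc]
      _ = r * c * (w * (q * d)) * q := by rw [e]; simp only [mul_assoc]
      _ = r * (c * q * d) * q := by rw [d4]; simp only [mul_assoc]

theorem eqvA_of_inter_nonempty (h : Structured N Z) (hA : IsAtlas N Z A) {a b : S}
    (hab : ((ZAset Z A * ({a} : Set S) * AZset Z A) ∩
      (ZAset Z A * ({b} : Set S) * AZset Z A)).Nonempty) : eqvA N Z A a b := by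
  obtain ⟨_, ⟨_, ⟨y, hy, _, rfl, rfl⟩, z, hz, rfl⟩, ⟨_, ⟨x, hx, _, rfl, rfl⟩, w, hw, e⟩⟩ := hab
  obtain ⟨s, hs, s1, s2⟩ := hA.exists_dual_absorb_right h hy hx
  obtain ⟨t, ht, t1, t2⟩ := hA.exists_dual_absorb_left h hz hw
  refine ⟨s, hs, t, ht, ?_⟩
  rename_i a b
  replace e : x * b * w = y * a * z := e
  calc s * a * t = s * y * a * (z * t) := by rw [s1, t1]
    _ = s * (y * a * z) * t := by simp only [mul_assoc]
    _ = s * x * b * (w * t) := by rw [← e]; simp only [mul_assoc]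
    _ = s * b * t := by rw [s2, t2]

theorem exists_dual_of_eqvA (h : Structured N Z) (hA : IsAtlas N Z A) {a b : S}
    (ha : a ∈ upClo N Z A) (hb : b ∈ upClo N Z A) (hab : eqvA N Z A a b) :
    ∃ s ∈ dualSet N Z A,
      s * a = s * b ∧ s * a ∈ AZset Z A ∧ a * s = b * s ∧ a * s ∈ ZAset Z A := by
  obtain ⟨s, hs, t, ht, hst⟩ := hab
  obtain ⟨c, hc, d, hcd⟩ := id hs
  obtain ⟨e, he, f, hef⟩ := id ht
  obtain ⟨a', ha', u, hu⟩ := id ha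
  obtain ⟨b', hb', v, hv⟩ := id hb
  have hus : u ∈ dualSet N Z A := ⟨a', ha', a, hu⟩
  have hvs : v ∈ dualSet N Z A := ⟨b', hb', b, hv⟩
  have hd : d ∈ upClo N Z A := ⟨c, hc, s, hcd⟩
  have hf : f ∈ upClo N Z A := ⟨e, he, t, hef⟩
  have hw : t * f * u * d * (s * a * t) * f * v * d * s ∈ dualSet N Z A :=
    hA.dual_mul_mem h (hA.dual_mul_mem h (hA.dual_mul_mem h (hA.dual_mul_mem h ht hf hus) hd
      (hA.dual_mul_mem h hs ha ht)) hf hvs) hd hs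
  obtain ⟨y, hy⟩ : ∃ y, y = d * s := ⟨_, rfl⟩
  obtain ⟨z, hz⟩ : ∃ z, z = t * f := ⟨_, rfl⟩
  have hyA : y ∈ ZAset Z A := hy ▸ ⟨hcd.2.2.2.2.1, c, hc, hcd.2.1⟩
  have hzA : z ∈ AZset Z A := hz ▸ ⟨hef.2.2.2.2.2, e, he, by rw [← mul_assoc]; exact hef.1⟩
  have hyz : y * a * z = y * b * z := by
    calc y * a * z = d * (s * a * t) * f := by rw [hy, hz]; simp only [mul_assoc]
      _ = y * b * z := by rw [hst, hy, hz]; simp only [mul_assoc]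
  have huya := hA.conj_mem_AZset h ha' hu hyA
  have hvyb := hA.conj_mem_AZset h hb' hv hyA
  have hazu := hA.conj_mem_ZAset h ha' hu hzA
  have hbzv := hA.conj_mem_ZAset h hb' hv hzA
  have hZN {p q : S} (hp : p ∈ Z) (hq : q ∈ Z) : p * q = q * p := h.zComm _ hp _ (h.zSubN hq)
  have hva : u * y * a * z * (v * y * a) ∈ Z := by
    rw [show u * y * a * z * (v * y * a) = u * (y * a * z) * (v * y * a) by
      simp only [mul_assoc], hyz, show u * (y * b * z) * (v * y * a)
        = u * (y * (b * z * v) * y) * a by simp only [mul_assoc]]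
    exact (h.binormal u a hu.2.2.2.2.2 hu.2.2.2.2.1 _
      (h.zMul _ (h.zMul _ hyA.1 _ hbzv.1) _ hyA.1)).1
  have hvb : u * y * a * z * (v * y * b) ∈ AZset Z A :=
    hA.AZset_mul_mem h (hA.AZset_mul_mem h huya hzA) hvyb
  have hau' : a * z * u * (y * a * z) * v = a * z * u * y * (b * z * v) := by
    rw [hyz]; simp only [mul_assoc]
  have hau : a * z * u * (y * a * z) * v ∈ ZAset Z A := by
    rw [hau']
    exact hA.ZAset_mul_mem h (hA.ZAset_mul_mem h hazu hyA) hbzv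
  have hbu : b * (z * (u * y * a) * z) * v ∈ Z :=
    (h.binormal b v hv.2.2.2.2.1 hv.2.2.2.2.2 _
      (h.zMul _ (h.zMul _ hzA.1 _ huya.1) _ hzA.1)).1
  obtain ⟨w, hwdef⟩ : ∃ w, w = z * u * y * a * z * v * y := ⟨_, rfl⟩
  have hwa : w * a = w * b := by
    calc w * a = z * (u * y * a * z * (v * y * a)) := by rw [hwdef]; simp only [mul_assoc]
      _ = u * y * a * z * v * (y * a * z) := by rw [hZN hzA.1 hva]; simp only [mul_assoc]
      _ = u * y * a * z * (v * y * b) * z := by rw [hyz]; simp only [mul_assoc]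
      _ = w * b := by rw [← hZN hzA.1 hvb.1, hwdef]; simp only [mul_assoc]
  have haw' : a * w = a * z * u * (y * a * z) * v * y := by rw [hwdef]; simp only [mul_assoc]
  have haw : a * w = b * w := by
    calc a * w = y * a * z * (u * y * a * z * v) := by
          rw [haw', ← hZN hyA.1 hau.1]; simp only [mul_assoc]
      _ = y * (b * (z * (u * y * a) * z) * v) := by rw [hyz]; simp only [mul_assoc]
      _ = b * w := by rw [hZN hyA.1 hbu, hwdef]; simp only [mul_assoc]
  refine ⟨w, ?_, hwa, ?_, haw, ?_⟩
  · rw [hwdef, hy, hz]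
    simpa only [mul_assoc] using hw
  · rw [hwa, show w * b = z * (u * y * a * z * (v * y * b)) by rw [hwdef]; simp only [mul_assoc]]
    exact hA.AZset_mul_mem h hzA hvb
  · rw [haw']
    exact hA.ZAset_mul_mem h hau hyA

end Auxiliary

theorem stmt18 [Semigroup S] (N Z : Set S) (h : Structured N Z) (A : Set S)
    (hA : IsAtlas N Z A) (a b : S)
    (ha : a ∈ upClo N Z A) (hb : b ∈ upClo N Z A) :
    (eqvA N Z A a b ↔
      ((ZAset Z A * ({a} : Set S) * AZset Z A) ∩
        (ZAset Z A * ({b} : Set S) * AZset Z A)).Nonempty) ∧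
    (eqvA N Z A a b ↔
      ∃ s ∈ dualSet N Z A,
        s * a = s * b ∧ s * a ∈ AZset Z A ∧ a * s = b * s ∧ a * s ∈ ZAset Z A) := by
  refine ⟨⟨fun hab => ?_, eqvA_of_inter_nonempty h hA⟩, exists_dual_of_eqvA h hA ha hb,
    fun ⟨s, hs, e, _⟩ => ⟨s, hs, s, hs, by rw [e]⟩⟩
  obtain ⟨s, -, e, hsa, e', has⟩ := exists_dual_of_eqvA h hA ha hb hab
  refine ⟨a * s * a * (s * a),
    Set.mul_mem_mul (Set.mul_mem_mul has (Set.mem_singleton a)) hsa, ?_⟩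
  rw [show a * s * a * (s * a) = a * s * b * (s * a) by
    rw [mul_assoc a s a, e, ← mul_assoc a s b]]
  exact Set.mul_mem_mul (Set.mul_mem_mul has (Set.mem_singleton b)) hsa
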